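/- (Second-moment bound in the scan regime.) Let α > 0. There exist constants c_μ > 0 and C* ≥ 1 depending only on α such that the following holds for all positive integers d₁, d₂, all integers 1 ≤ s₁ ≤ d₁/2, 1 ≤ s₂ ≤ d₂, and every c̄ ∈ (0, (2e)^{−4}) with s₁² ≤ c̄·d₁·s₂ and s₂ < s₁·log(d₁s₂/s₁²): (a) if μ > 0 satisfies μ² ≤ (c_μ/s₂)·log( (s₂d₁/(2e·s₁²))·log(d₂/s₂) ), then E[ exp(μ²·X·Y)·1( X ≥ max( s₂/log(d₁s₂/s₁²), C*·s₁²/d₁ ) ) ] < α; (b) if moreover d₂/s₂ ≥ 2/(1 − e^{−c_μ}) and s₁ < s₂·log(d₂/s₂), then μ² ≤ (c_μ/s₂)·log(d₁/(2e·s₁)) + (1/s₁)·log( (1 − e^{−c_μ})·d₂/s₂ ) implies E[ exp(μ²·X·Y)·1( X > max( s₂/log(d₁s₂/s₁²), C*·s₁²/d₁ ) ) ] < α. -/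

import Mathlib

/-- The binomial point mass: P(X = k) for X ~ Binomial(n, p). -/
noncomputable def binomP (n : ℕ) (p : ℝ) (k : ℕ) : ℝ :=
  (n.choose k : ℝ) * p ^ k * (1 - p) ^ (n - k)

/-- Expectation E[f(X,Y)] for independent X ~ Binomial(s₁, s₁/d₁) and
Y ~ Binomial(s₂, s₂/d₂). -/
noncomputable def Eexp (s₁ s₂ d₁ d₂ : ℕ) (f : ℕ → ℕ → ℝ) : ℝ :=
  ∑ k ∈ Finset.range (s₁ + 1), ∑ l ∈ Finset.range (s₂ + 1),
    binomP s₁ ((s₁ : ℝ) / (d₁ : ℝ)) k * binomP s₂ ((s₂ : ℝ) / (d₂ : ℝ)) l * f k l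

theorem sum_binomP_mul_exp (n : ℕ) (p z : ℝ) :
    ∑ l ∈ Finset.range (n + 1), binomP n p l * Real.exp (z * l) =
      (1 + p * (Real.exp z - 1)) ^ n := by
  have h : 1 + p * (Real.exp z - 1) = p * Real.exp z + (1 - p) := by ring
  rw [h, add_pow]
  refine Finset.sum_congr rfl fun l _ => ?_
  rw [binomP, mul_pow, ← Real.exp_nat_mul, mul_comm (l : ℝ) z]
  ring

theorem binomP_nonneg {n : ℕ} {p : ℝ} (h0 : 0 ≤ p) (h1 : p ≤ 1) (k : ℕ) : 0 ≤ binomP n p k := by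
  have : 0 ≤ 1 - p := sub_nonneg.2 h1
  unfold binomP
  positivity

theorem binomP_le {n k : ℕ} {p : ℝ} (h0 : 0 ≤ p) (h1 : p ≤ 1) (hk : 1 ≤ k) :
    binomP n p k ≤ (Real.exp 1 * (n * p) / k) ^ k := by
  have hk' : (0 : ℝ) < k := by exact_mod_cast hk
  have hfac : ((k : ℝ) ^ k) ≤ Real.exp 1 ^ k * k.factorial := by
    have h := Real.pow_div_factorial_le_exp (k : ℝ) hk'.le k
    rw [div_le_iff₀ (by positivity)] at h
    simpa [← Real.exp_nat_mul] using h
  have hch : (n.choose k : ℝ) ≤ (n : ℝ) ^ k / k.factorial := Nat.choose_le_pow_div k n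
  have h1p : (1 - p) ^ (n - k) ≤ 1 := pow_le_one₀ (by linarith) (by linarith)
  calc binomP n p k ≤ (n.choose k : ℝ) * p ^ k := by
        unfold binomP
        exact mul_le_of_le_one_right (by positivity) h1p
    _ ≤ (n : ℝ) ^ k / k.factorial * p ^ k := by gcongr
    _ ≤ (Real.exp 1 * (n * p) / k) ^ k := by
        rw [div_pow, mul_pow, mul_pow, div_mul_eq_mul_div,
          div_le_div_iff₀ (by positivity) (by positivity)]
        calc (n : ℝ) ^ k * p ^ k * (k : ℝ) ^ k
            ≤ (n : ℝ) ^ k * p ^ k * (Real.exp 1 ^ k * k.factorial) := by gcongr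
          _ = _ := by ring

/-- If on the event `P` the conditional moment generating function of `Y` is at most half (on the
logarithmic scale) of the inverse tail of `X`, the truncated second moment is geometric. -/
theorem Eexp_exp_mul_ite_le {s₁ s₂ d₁ d₂ : ℕ} {m r : ℝ} (P : ℕ → Prop) [DecidablePred P]
    (hd₁ : 0 < d₁) (hs₁ : 1 ≤ s₁) (hsd₁ : s₁ ≤ d₁)
    (hr0 : 0 < r) (hr : r ≤ 1 / 2)
    (hP : ∀ k, k ≤ s₁ → P k → 1 ≤ k ∧
      (Real.exp 1 / r) ^ 2 ≤ (k : ℝ) * d₁ / (s₁ : ℝ) ^ 2 ∧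
      (1 + (s₂ : ℝ) / d₂ * (Real.exp (m * k) - 1)) ^ s₂ ≤
        Real.exp (k / 2 * Real.log ((k : ℝ) * d₁ / (s₁ : ℝ) ^ 2))) :
    Eexp s₁ s₂ d₁ d₂ (fun k l => Real.exp (m * k * l) * (if P k then (1 : ℝ) else 0)) ≤ 2 * r := by
  have hd₁' : (0 : ℝ) < d₁ := by exact_mod_cast hd₁
  have hs₁' : (0 : ℝ) < s₁ := by exact_mod_cast hs₁
  have hp0 : (0 : ℝ) ≤ (s₁ : ℝ) / d₁ := by positivity
  have hp1 : (s₁ : ℝ) / d₁ ≤ 1 := (div_le_one hd₁').2 (by exact_mod_cast hsd₁)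
  have hterm : ∀ k ∈ Finset.range (s₁ + 1),
      ∑ l ∈ Finset.range (s₂ + 1), binomP s₁ ((s₁ : ℝ) / d₁) k * binomP s₂ ((s₂ : ℝ) / d₂) l *
        (Real.exp (m * k * l) * (if P k then (1 : ℝ) else 0)) ≤ if k = 0 then 0 else r ^ k := by
    intro k hk
    have hks : k ≤ s₁ := Nat.lt_succ_iff.1 (Finset.mem_range.1 hk)
    by_cases hPk : P k
    · obtain ⟨hk1, hC, hG⟩ := hP k hks hPk
      have hk' : (0 : ℝ) < k := by exact_mod_cast hk1
      rw [if_neg (show ¬k = 0 by omega)]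
      set W : ℝ := (k : ℝ) * d₁ / (s₁ : ℝ) ^ 2 with hW
      have hW0 : 0 < W := by positivity
      have hsum : ∑ l ∈ Finset.range (s₂ + 1), binomP s₁ ((s₁ : ℝ) / d₁) k *
          binomP s₂ ((s₂ : ℝ) / d₂) l * (Real.exp (m * k * l) * (if P k then (1 : ℝ) else 0)) =
          binomP s₁ ((s₁ : ℝ) / d₁) k * (1 + (s₂ : ℝ) / d₂ * (Real.exp (m * k) - 1)) ^ s₂ := by
        rw [← sum_binomP_mul_exp, Finset.mul_sum]
        refine Finset.sum_congr rfl fun l _ => ?_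
        rw [if_pos hPk]
        ring
      have hsqrt : Real.exp (k / 2 * Real.log W) = √W ^ k := by
        rw [Real.sqrt_eq_rpow, Real.rpow_def_of_pos hW0, ← Real.exp_nat_mul]
        ring_nf
      have hb : binomP s₁ ((s₁ : ℝ) / d₁) k ≤ (Real.exp 1 / W) ^ k := by
        refine (binomP_le hp0 hp1 hk1).trans_eq ?_
        congr 1
        rw [hW]
        field_simp
      have hsW : Real.exp 1 / r ≤ √W := Real.le_sqrt_of_sq_le hC
      have hsW0 : 0 < √W := Real.sqrt_pos.2 hW0
      rw [hsum]
      calc _ ≤ (Real.exp 1 / W) ^ k * √W ^ k := by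
            rw [← hsqrt]
            exact (mul_le_mul_of_nonneg_left hG (binomP_nonneg hp0 hp1 k)).trans
              (mul_le_mul_of_nonneg_right hb (Real.exp_nonneg _))
        _ = (Real.exp 1 / √W) ^ k := by
            rw [← mul_pow]
            congr 1
            rw [div_mul_eq_mul_div, div_eq_div_iff hW0.ne' hsW0.ne', mul_assoc,
              Real.mul_self_sqrt hW0.le]
        _ ≤ r ^ k := by
            gcongr
            rw [div_le_iff₀ hsW0]
            rw [div_le_iff₀ hr0] at hsW
            linarith
    · simp only [if_neg hPk, mul_zero, Finset.sum_const_zero]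
      split_ifs <;> positivity
  have hgeom : ∑ k ∈ Finset.range (s₁ + 1), (if k = 0 then 0 else r ^ k) ≤ 2 * r := by
    rw [Finset.sum_range_succ']
    simp only [Nat.add_eq_zero_iff, one_ne_zero, and_false, if_false, if_true, add_zero, pow_succ]
    rw [← Finset.sum_mul]
    have hs := geom_sum_mul_neg r s₁
    have hpw : 0 ≤ r ^ s₁ := by positivity
    have hS : 0 ≤ ∑ i ∈ Finset.range s₁, r ^ i := by positivity
    nlinarith
  exact (Finset.sum_le_sum hterm).trans hgeom

theorem half_log_le_log_mul {A x : ℝ} (hA : 256 ≤ A) (hx : 1 ≤ x * Real.log A) :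
    5 ≤ Real.log A ∧ 0 < x ∧ Real.log A / 2 ≤ Real.log (A * x) ∧ 1 / 2 ≤ x * Real.log (A * x) := by
  have ha : 5 ≤ Real.log A := by
    have h1 : Real.log 256 ≤ Real.log A := Real.log_le_log (by norm_num) hA
    have h2 : Real.log 256 = 8 * Real.log 2 := by
      rw [show (256 : ℝ) = 2 ^ 8 by norm_num, Real.log_pow]; norm_num
    linarith [Real.log_two_gt_d9]
  have hx0 : 0 < x := by
    by_contra! h
    nlinarith
  have hlog : Real.log A / 2 ≤ Real.log (A * x) := by
    rw [Real.log_mul (by positivity) hx0.ne']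
    have hxl : -Real.log (Real.log A) ≤ Real.log x := by
      rw [← Real.log_inv]
      apply Real.log_le_log (by positivity)
      rw [inv_le_iff_one_le_mul₀ (by positivity)]
      linarith
    have hll : Real.log (Real.log A) ≤ Real.log A / 2 := by
      rw [Real.log_le_iff_le_exp (by linarith)]
      have := Real.quadratic_le_exp_of_nonneg (x := Real.log A / 2) (by linarith)
      nlinarith
    linarith
  refine ⟨ha, hx0, hlog, ?_⟩
  nlinarith

theorem one_add_mul_exp_sub_one_le_exp_half {R A x m : ℝ} (hR : 1 < R) (hA : 256 ≤ A)
    (hx : 1 ≤ x * Real.log A)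
    (hm : m ≤ 1 / 128 * (Real.log A + Real.log (Real.log R))) :
    1 + R⁻¹ * (Real.exp (m * x) - 1) ≤ Real.exp (x / 2 * Real.log (A * x)) := by
  obtain ⟨ha, hx0, hU, hxU⟩ := half_log_le_log_mul hA hx
  have hR0 : 0 < R := by linarith
  have hT : 0 < Real.log R := Real.log_pos hR
  have hAx : 0 < A * x := by positivity
  have hxe : A * x = Real.exp (Real.log (A * x)) := (Real.exp_log hAx).symm
  have hTe : Real.log R = Real.exp (Real.log (Real.log R)) := (Real.exp_log hT).symm
  have hRe : R⁻¹ = Real.exp (-Real.log R) := by rw [Real.exp_neg, Real.exp_log hR0]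
  set a := Real.log A
  set U := Real.log (A * x)
  set t := Real.log (Real.log R)
  set T := Real.log R
  rcases le_or_gt m (U / 2) with h | h
  · rcases le_or_gt 0 (m * x) with h0 | h0
    · have h1 : R⁻¹ * (Real.exp (m * x) - 1) ≤ Real.exp (m * x) - 1 :=
        mul_le_of_le_one_left (by linarith [Real.one_le_exp h0]) (inv_le_one_of_one_le₀ hR.le)
      have h2 : Real.exp (m * x) ≤ Real.exp (x / 2 * U) := Real.exp_le_exp.2 (by nlinarith)
      linarith
    · have h1 : R⁻¹ * (Real.exp (m * x) - 1) ≤ 0 :=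
        mul_nonpos_of_nonneg_of_nonpos (by positivity)
          (by linarith [Real.exp_le_one_iff.2 h0.le])
      have h2 : 1 ≤ Real.exp (x / 2 * U) := Real.one_le_exp (by nlinarith)
      linarith
  · have ht : 62 * U < t := by linarith
    have hxle : x ≤ Real.exp (t / 2) := by
      have h1 : Real.exp U ≤ Real.exp (t / 2) := Real.exp_le_exp.2 (by linarith)
      nlinarith
    have htle : t / 2 ≤ Real.exp (t / 2) := by linarith [Real.add_one_le_exp (t / 2)]
    have hTT : T = Real.exp (t / 2) * Real.exp (t / 2) := by
      rw [hTe, ← Real.exp_add]; ring_nf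
    have hmt : m ≤ t / 4 := by linarith
    have hmx : m * x ≤ T / 2 := by
      rw [hTT]
      have : 0 < Real.exp (t / 2) := Real.exp_pos _
      calc m * x ≤ (Real.exp (t / 2) / 2) * Real.exp (t / 2) :=
            mul_le_mul (by linarith) hxle hx0.le (by positivity)
        _ = _ := by ring
    have hTt : t ≤ T := by
      rw [hTe]
      linarith [Real.add_one_le_exp t]
    have h1 : R⁻¹ * Real.exp (m * x) ≤ 1 / 4 := by
      rw [hRe, ← Real.exp_add]
      calc Real.exp (-T + m * x) ≤ Real.exp (-(T / 2)) := Real.exp_le_exp.2 (by linarith)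
        _ ≤ 1 / 4 := by
          rw [Real.exp_neg, inv_le_comm₀ (Real.exp_pos _) (by norm_num)]
          linarith [Real.add_one_le_exp (T / 2)]
    have h2 := Real.add_one_le_exp (x / 2 * U)
    have h3 : 0 < R⁻¹ := by positivity
    nlinarith

theorem one_add_mul_exp_sub_one_le_exp_half_of_le {R A D x y δ z : ℝ} (hR : 256 ≤ R)
    (hA : 256 ≤ A) (hx : 1 ≤ x * Real.log A) (hD : 0 < D) (hδ0 : 0 < δ) (hδ : δ ≤ 1 / 64)
    (hy0 : 0 < y) (hy1 : y ≤ 1) (hAx : A * x = y * D) (hxy : x ≤ y * Real.log R)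
    (hz : z ≤ 1 / 128 * x * Real.log D + y * Real.log (δ * R)) :
    1 + R⁻¹ * (Real.exp z - 1) ≤ Real.exp (x / 2 * Real.log (A * x)) := by
  obtain ⟨ha, hx0, hU, hxU⟩ := half_log_le_log_mul hA hx
  have hR0 : 0 < R := by linarith
  have hRe : R⁻¹ = Real.exp (-Real.log R) := by rw [Real.exp_neg, Real.exp_log hR0]
  have hR' : 0 < R⁻¹ := by positivity
  have hT : 8 * Real.log 2 ≤ Real.log R := by
    have h1 : Real.log 256 ≤ Real.log R := Real.log_le_log (by norm_num) hR
    have h2 : Real.log 256 = 8 * Real.log 2 := by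
      rw [show (256 : ℝ) = 2 ^ 8 by norm_num, Real.log_pow]; norm_num
    linarith
  have hδl : Real.log δ ≤ -(6 * Real.log 2) := by
    have h1 : Real.log δ ≤ Real.log (1 / 64) := Real.log_le_log hδ0 hδ
    have h2 : Real.log (1 / 64) = -(6 * Real.log 2) := by
      rw [show (1 / 64 : ℝ) = (2 ^ 6)⁻¹ by norm_num, Real.log_inv, Real.log_pow]; norm_num
    linarith
  have hl2 := Real.log_two_gt_d9
  have e2 : Real.exp (Real.log 2) = 2 := Real.exp_log (by norm_num)
  rw [Real.log_mul hδ0.ne' hR0.ne'] at hz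
  have hUw : Real.log (A * x) = Real.log y + Real.log D := by
    rw [hAx, Real.log_mul hy0.ne' hD.ne']
  have hly : Real.log y ≤ 0 := Real.log_nonpos hy0.le hy1
  have hye : y = Real.exp (Real.log y) := (Real.exp_log hy0).symm
  set U := Real.log (A * x)
  set T := Real.log R
  set w := Real.log D
  rcases le_or_gt w (32 * U) with h | h
  · have hE : y * (Real.log δ + T) - T ≤ -(6 * Real.log 2) := by nlinarith
    have h1 : R⁻¹ * Real.exp z ≤ Real.exp (x * U / 4) * (1 / 8) := by
      rw [hRe, ← Real.exp_add]
      calc Real.exp (-T + z) ≤ Real.exp (x * U / 4 + -(6 * Real.log 2)) :=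
            Real.exp_le_exp.2 (by nlinarith)
        _ ≤ _ := by
          rw [Real.exp_add]
          gcongr
          rw [show -(6 * Real.log 2) = -((6 : ℕ) * Real.log 2) by norm_num, Real.exp_neg,
            Real.exp_nat_mul, e2]
          norm_num
    have h2 : 1 ≤ Real.exp (x * U / 4) := Real.one_le_exp (by linarith)
    have h3 : Real.exp (x / 2 * U) = Real.exp (x * U / 4) * Real.exp (x * U / 4) := by
      rw [← Real.exp_add]; ring_nf
    have h4 := Real.add_one_le_exp (x * U / 4)
    rw [h3]
    nlinarith
  · have hyw : y * (1 + (w - U)) ≤ 1 := by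
      have h1 := Real.add_one_le_exp (w - U)
      have h2 : y * Real.exp (w - U) = 1 := by
        rw [hye, ← Real.exp_add, hUw, Real.exp_eq_one_iff]
        ring
      nlinarith
    have hy2 : y ≤ 1 / 2 := by nlinarith
    have hyw2 : y * w ≤ 2 := by nlinarith
    have hw0 : 0 ≤ w := by linarith
    have hT0 : 0 ≤ T := by linarith
    have hxw : x * w ≤ 2 * T := by
      calc x * w ≤ (y * T) * w := by gcongr
        _ = (y * w) * T := by ring
        _ ≤ 2 * T := by gcongr
    have h1 : R⁻¹ * Real.exp z ≤ 1 / 4 := by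
      rw [hRe, ← Real.exp_add]
      calc Real.exp (-T + z) ≤ Real.exp (-((2 : ℕ) * Real.log 2)) := by
            refine Real.exp_le_exp.2 ?_
            push_cast
            nlinarith
        _ ≤ 1 / 4 := by
          rw [Real.exp_neg, Real.exp_nat_mul, e2]
          norm_num
    have h2 := Real.add_one_le_exp (x / 2 * U)
    nlinarith

/-- Raise a pointwise bound with `x = k / n` to the power `n`. -/
theorem pow_le_exp_of_le_exp_div {n k b W : ℝ} {N : ℕ} (hN : (N : ℝ) = n) (hn : 0 < n)
    (hb : 0 ≤ b) (h : b ≤ Real.exp (k / n / 2 * W)) : b ^ N ≤ Real.exp (k / 2 * W) := by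
  calc b ^ N ≤ Real.exp (k / n / 2 * W) ^ N := by gcongr
    _ = _ := by
      rw [← Real.exp_nat_mul, hN]
      congr 1
      field_simp

theorem one_add_mul_exp_sub_one_nonneg {q z : ℝ} (h0 : 0 ≤ q) (h1 : q ≤ 1) :
    0 ≤ 1 + q * (Real.exp z - 1) := by
  nlinarith [Real.exp_pos z]

/-- Second-moment bound in the scan regime (Lemma A.3). -/
theorem scan_regime_bound (α : ℝ) (hα : 0 < α) :
    ∃ cμ Cs : ℝ, 0 < cμ ∧ 1 ≤ Cs ∧
      ∀ (d₁ d₂ s₁ s₂ : ℕ), 0 < d₁ → 0 < d₂ →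
        1 ≤ s₁ → 2 * s₁ ≤ d₁ → 1 ≤ s₂ → s₂ ≤ d₂ →
        ∀ cbar : ℝ, 0 < cbar → cbar < 1 / (2 * Real.exp 1) ^ 4 →
          (s₁ : ℝ) ^ 2 ≤ cbar * (d₁ : ℝ) * (s₂ : ℝ) →
          (s₂ : ℝ) < (s₁ : ℝ) *
            Real.log ((d₁ : ℝ) * (s₂ : ℝ) / (s₁ : ℝ) ^ 2) →
          ((∀ μ : ℝ, 0 < μ →
            μ ^ 2 ≤ (cμ / (s₂ : ℝ)) *
              Real.log (((s₂ : ℝ) * (d₁ : ℝ) /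
                  (2 * Real.exp 1 * (s₁ : ℝ) ^ 2)) *
                Real.log ((d₂ : ℝ) / (s₂ : ℝ))) →
            Eexp s₁ s₂ d₁ d₂ (fun k l =>
              Real.exp (μ ^ 2 * (k : ℝ) * (l : ℝ)) *
                (if max ((s₂ : ℝ) /
                      Real.log ((d₁ : ℝ) * (s₂ : ℝ) / (s₁ : ℝ) ^ 2))
                    (Cs * (s₁ : ℝ) ^ 2 / (d₁ : ℝ)) ≤ (k : ℝ)
                  then (1 : ℝ) else 0)) < α) ∧
          (2 / (1 - Real.exp (-cμ)) ≤ (d₂ : ℝ) / (s₂ : ℝ) →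
            (s₁ : ℝ) < (s₂ : ℝ) * Real.log ((d₂ : ℝ) / (s₂ : ℝ)) →
            ∀ μ : ℝ, 0 < μ →
              μ ^ 2 ≤ (cμ / (s₂ : ℝ)) *
                  Real.log ((d₁ : ℝ) / (2 * Real.exp 1 * (s₁ : ℝ))) +
                (1 / (s₁ : ℝ)) *
                  Real.log ((1 - Real.exp (-cμ)) * (d₂ : ℝ) / (s₂ : ℝ)) →
              Eexp s₁ s₂ d₁ d₂ (fun k l =>
                Real.exp (μ ^ 2 * (k : ℝ) * (l : ℝ)) *
                  (if max ((s₂ : ℝ) /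
                        Real.log ((d₁ : ℝ) * (s₂ : ℝ) / (s₁ : ℝ) ^ 2))
                      (Cs * (s₁ : ℝ) ^ 2 / (d₁ : ℝ)) < (k : ℝ)
                    then (1 : ℝ) else 0)) < α)) := by
  set r : ℝ := min (1 / 2) (α / 4) with hr
  have hr0 : 0 < r := lt_min (by norm_num) (by linarith)
  have hr1 : r ≤ 1 / 2 := min_le_left _ _
  have hrα : 2 * r < α := by linarith [min_le_right (1 / 2) (α / 4)]
  have he : 2 < Real.exp 1 := by linarith [Real.exp_one_gt_d9]
  refine ⟨1 / 128, (Real.exp 1 / r) ^ 2, by norm_num, ?_, ?_⟩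
  · exact one_le_pow₀ ((one_le_div hr0).2 (by linarith))
  intro d₁ d₂ s₁ s₂ hd₁ hd₂ hs₁ hsd₁ hs₂ hsd₂ cbar hc0 hc1 hcb hs₂L
  have hd₁' : (0 : ℝ) < d₁ := by exact_mod_cast hd₁
  have hd₂' : (0 : ℝ) < d₂ := by exact_mod_cast hd₂
  have hs₁' : (0 : ℝ) < s₁ := by exact_mod_cast hs₁
  have hs₂' : (0 : ℝ) < s₂ := by exact_mod_cast hs₂
  have hsd₂' : (s₂ : ℝ) ≤ d₂ := by exact_mod_cast hsd₂
  have hq : (s₂ : ℝ) / d₂ = ((d₂ : ℝ) / s₂)⁻¹ := (inv_div _ _).symm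
  have hq1 : (s₂ : ℝ) / d₂ ≤ 1 := (div_le_one hd₂').2 hsd₂'
  have hR1 : 1 ≤ (d₂ : ℝ) / s₂ := (one_le_div hs₂').2 hsd₂'
  have hA : 256 ≤ (d₁ : ℝ) * s₂ / (s₁ : ℝ) ^ 2 := by
    rw [le_div_iff₀ (by positivity)]
    have h1 : (256 : ℝ) ≤ (2 * Real.exp 1) ^ 4 := by
      calc (256 : ℝ) = (2 * 2) ^ 4 := by norm_num
        _ ≤ _ := by gcongr
    have h2 : cbar ≤ 1 / 256 := hc1.le.trans (one_div_le_one_div_of_le (by norm_num) h1)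
    have h3 : cbar * (d₁ * s₂) ≤ 1 / 256 * (d₁ * s₂) := by gcongr
    linarith
  set A : ℝ := (d₁ : ℝ) * s₂ / (s₁ : ℝ) ^ 2 with hAdef
  set R : ℝ := (d₂ : ℝ) / s₂ with hRdef
  have hlogA : 0 < Real.log A := Real.log_pos (by linarith)
  have hW : ∀ k : ℕ, (k : ℝ) * d₁ / (s₁ : ℝ) ^ 2 = A * (k / s₂) := by
    intro k
    rw [hAdef]
    field_simp
  have hthr : ∀ k : ℕ, max ((s₂ : ℝ) / Real.log A) ((Real.exp 1 / r) ^ 2 * (s₁ : ℝ) ^ 2 / d₁) ≤ k →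
      1 ≤ k ∧ (Real.exp 1 / r) ^ 2 ≤ (k : ℝ) * d₁ / (s₁ : ℝ) ^ 2 ∧
        1 ≤ (k : ℝ) / s₂ * Real.log A := by
    intro k hk
    have hk1 := (le_max_left _ _).trans hk
    have hk2 := (le_max_right _ _).trans hk
    refine ⟨?_, ?_, ?_⟩
    · have : (0 : ℝ) < k := lt_of_lt_of_le (by positivity) hk1
      exact_mod_cast this
    · rw [div_le_iff₀ hd₁'] at hk2
      rwa [le_div_iff₀ (by positivity)]
    · rw [div_le_iff₀ hlogA] at hk1
      rwa [div_mul_eq_mul_div, one_le_div hs₂']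
  refine ⟨?_, ?_⟩
  · intro μ hμ hμle
    refine lt_of_le_of_lt (Eexp_exp_mul_ite_le _ hd₁ hs₁ (by omega) hr0 hr1 ?_) hrα
    intro k hks hk
    obtain ⟨hk1, hkC, hkL⟩ := hthr k hk
    refine ⟨hk1, hkC, pow_le_exp_of_le_exp_div rfl hs₂'
      (one_add_mul_exp_sub_one_nonneg (by positivity) hq1) ?_⟩
    have hT : 0 < Real.log R := by
      rcases (Real.log_nonneg hR1).lt_or_eq with h | h
      · exact h
      · rw [← h] at hμle
        simp only [mul_zero, Real.log_zero] at hμle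
        linarith [pow_pos hμ 2]
    have hR : 1 < R := (Real.log_pos_iff (by linarith)).1 hT
    have hm : μ ^ 2 * s₂ ≤ 1 / 128 * (Real.log A + Real.log (Real.log R)) := by
      rw [← Real.log_mul (by positivity) hT.ne']
      have h1 : (s₂ : ℝ) * d₁ / (2 * Real.exp 1 * (s₁ : ℝ) ^ 2) * Real.log R ≤ A * Real.log R := by
        refine mul_le_mul_of_nonneg_right ?_ hT.le
        rw [hAdef, mul_comm (s₂ : ℝ)]
        gcongr
        nlinarith [sq_nonneg (s₁ : ℝ)]
      have h2 := Real.log_le_log (by positivity) h1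
      calc μ ^ 2 * s₂ ≤ 1 / 128 / s₂ * Real.log (A * Real.log R) * s₂ := by
            refine mul_le_mul_of_nonneg_right (hμle.trans ?_) hs₂'.le
            gcongr
        _ = _ := by field_simp
    have := one_add_mul_exp_sub_one_le_exp_half hR hA hkL hm
    rw [hq, hW, show μ ^ 2 * (k : ℝ) = μ ^ 2 * s₂ * (k / s₂) by field_simp]
    exact this
  · intro hRδ hs₁T μ hμ hμle
    refine lt_of_le_of_lt (Eexp_exp_mul_ite_le _ hd₁ hs₁ (by omega) hr0 hr1 ?_) hrα
    intro k hks hk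
    obtain ⟨hk1, hkC, hkL⟩ := hthr k hk.le
    refine ⟨hk1, hkC, pow_le_exp_of_le_exp_div rfl hs₂'
      (one_add_mul_exp_sub_one_nonneg (by positivity) hq1) ?_⟩
    set δ : ℝ := 1 - Real.exp (-(1 / 128)) with hδdef
    have hδ0 : 0 < δ := sub_pos.2 (Real.exp_lt_one_iff.2 (by norm_num))
    have hδ : δ ≤ 1 / 128 := by linarith [Real.add_one_le_exp (-(1 / 128 : ℝ))]
    have hR : 256 ≤ R := by
      refine le_trans ?_ hRδ
      rw [le_div_iff₀ hδ0]
      linarith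
    have hk' : (0 : ℝ) < k := by exact_mod_cast hk1
    have hks' : (k : ℝ) ≤ s₁ := by exact_mod_cast hks
    rw [hq, hW]
    refine one_add_mul_exp_sub_one_le_exp_half_of_le (D := d₁ / s₁) (y := k / s₁) (δ := δ) hR hA hkL
      (by positivity) hδ0 (by linarith) (by positivity) ((div_le_one hs₁').2 hks') ?_ ?_ ?_
    · rw [hAdef]
      field_simp
    · rw [div_le_iff₀ hs₂']
      calc (k : ℝ) = k / s₁ * s₁ := by field_simp
        _ ≤ k / s₁ * (s₂ * Real.log R) := by gcongr
        _ = _ := by ring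
    · have h1 : Real.log ((d₁ : ℝ) / (2 * Real.exp 1 * s₁)) ≤ Real.log ((d₁ : ℝ) / s₁) := by
        refine Real.log_le_log (by positivity) ?_
        gcongr
        nlinarith
      rw [mul_div_assoc, ← hRdef] at hμle
      calc μ ^ 2 * (k : ℝ)
          ≤ (1 / 128 / s₂ * Real.log ((d₁ : ℝ) / s₁) + 1 / s₁ * Real.log (δ * R)) * k := by
            refine mul_le_mul_of_nonneg_right (hμle.trans ?_) hk'.le
            gcongr
        _ = _ := by ring
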